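/- arXiv:1606.00978 — 3 statements merged into one kernel-verified Lean document; each statement's English description precedes it below -/
import Mathlib

section
/- (Local structure of formal Bethe vectors, XXZ case.) Let H be a complex vector space, N ≥ 1, and let ξ₁, …, ξ_N ∈ ℂ. For j = 1, …, N let Lⱼ(λ) = [[Aⱼ(λ),Bⱼ(λ)],[Cⱼ(λ),Dⱼ(λ)]] be monodromy matrices on H with common domain Λ ⊆ ℂ, each satisfying the RTT relation with the trigonometric (XXZ-type) R-matrix with anisotropy η, such that every matrix entry of Lᵢ(λ) commutes with every matrix entry of Lⱼ(μ) whenever i ≠ j. Suppose there is a nonzero vector |0⟩ ∈ H and scalar functions α, δ of two complex variables such that for all j and all λ ∈ Λ: Aⱼ(λ)|0⟩ = α(λ,ξⱼ)|0⟩, Dⱼ(λ)|0⟩ = δ(λ,ξⱼ)|0⟩, Cⱼ(λ)|0⟩ = 0, and moreover Bⱼ(λ)Bⱼ(μ)|0⟩ = 0 for all λ, μ ∈ Λ. Let B(λ) be the (1,2) entry of T(λ) = L₁(λ)⋯L_N(λ). Then for any λ₁, …, λ_M ∈ Λ with sinh(λⱼ−λ_k) ≠ 0 for all j ≠ k: B(λ₁)⋯B(λ_M)|0⟩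 = Σ_{1≤n₁<⋯<n_M≤N} Σ_{σ ∈ S_M} B_{n₁}(λ_{σ(1)}) ⋯ B_{n_M}(λ_{σ(M)}) |0⟩ × ∏_{l=1}^M [ ( ∏_{i=1}^{n_l−1} α(λ_{σ(l)},ξᵢ) ) ( ∏_{j=n_l+1}^{N} δ(λ_{σ(l)},ξⱼ) ) ( ∏_{r=l+1}^{M} f(λ_{σ(l)},λ_{σ(r)}) ) ], where f(λ,μ) = sinh(λ−μ+η)/sinh(λ−μ) and S_M is the symmetric group on {1,…,M}. -/
open scoped BigOperators

noncomputable section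

/-- The endomorphism algebra of a complex vector space `H`. -/
abbrev EndH (H : Type) [AddCommGroup H] [Module ℂ H] := Module.End ℂ H

/-- The 4×4 matrix `[[f,0,0,0],[0,1,g,0],[0,g,1,0],[0,0,0,f]]` acting on `ℂ² ⊗ ℂ²`,
indexed by `Fin 2 × Fin 2` (standard tensor basis). -/
def Rfg (f g : ℂ) : Matrix (Fin 2 × Fin 2) (Fin 2 × Fin 2) ℂ :=
  fun p q =>
    if p = q then (if p.1 = p.2 then f else 1)
    else if p.1 = q.2 ∧ p.2 = q.1 then g else 0

/-- Rational function `f(λ,μ) = (λ-μ+1)/(λ-μ)`. -/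
def fXXX (l m : ℂ) : ℂ := (l - m + 1) / (l - m)

/-- Rational function `g(λ,μ) = 1/(λ-μ)`. -/
def gXXX (l m : ℂ) : ℂ := 1 / (l - m)

/-- The rational (XXX-type) R-matrix. -/
def RXXX (l m : ℂ) : Matrix (Fin 2 × Fin 2) (Fin 2 × Fin 2) ℂ := Rfg (fXXX l m) (gXXX l m)

/-- Trigonometric `f(λ,μ) = sinh(λ-μ+η)/sinh(λ-μ)`. -/
def fXXZ (η l m : ℂ) : ℂ := Complex.sinh (l - m + η) / Complex.sinh (l - m)

/-- Trigonometric `g(λ,μ) = sinh η / sinh(λ-μ)`. -/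
def gXXZ (η l m : ℂ) : ℂ := Complex.sinh η / Complex.sinh (l - m)

/-- The trigonometric (XXZ-type) R-matrix with anisotropy `η`. -/
def RXXZ (η l m : ℂ) : Matrix (Fin 2 × Fin 2) (Fin 2 × Fin 2) ℂ :=
  Rfg (fXXZ η l m) (gXXZ η l m)

variable {H : Type} [AddCommGroup H] [Module ℂ H]

/-- `T₁(λ)`: the 2×2 operator matrix `T` acting in the first auxiliary space `ℂ²`
(and in `H`), identity in the second auxiliary space. -/
def aux1 (T : Matrix (Fin 2) (Fin 2) (EndH H)) :
    Matrix (Fin 2 × Fin 2) (Fin 2 × Fin 2) (EndH H) :=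
  fun p q => if p.2 = q.2 then T p.1 q.1 else 0

/-- `T₂(μ)`: the 2×2 operator matrix `T` acting in the second auxiliary space `ℂ²`
(and in `H`), identity in the first auxiliary space. -/
def aux2 (T : Matrix (Fin 2) (Fin 2) (EndH H)) :
    Matrix (Fin 2 × Fin 2) (Fin 2 × Fin 2) (EndH H) :=
  fun p q => if p.1 = q.1 then T p.2 q.2 else 0

/-- A scalar 4×4 matrix viewed as a matrix of endomorphisms of `H`
(i.e. `R ⊗ id_H` on `ℂ² ⊗ ℂ² ⊗ H`). -/
def embedR (R : Matrix (Fin 2 × Fin 2) (Fin 2 × Fin 2) ℂ) :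
    Matrix (Fin 2 × Fin 2) (Fin 2 × Fin 2) (EndH H) :=
  R.map (fun c => c • (1 : EndH H))

/-- The RTT relation `R₁₂(λ,μ) T₁(λ) T₂(μ) = T₂(μ) T₁(λ) R₁₂(λ,μ)` in
`End(ℂ² ⊗ ℂ² ⊗ H)`, for all `λ, μ ∈ Λ` which are admissible (`adm λ μ`). -/
def SatisfiesRTT (Λ : Set ℂ) (adm : ℂ → ℂ → Prop)
    (R : ℂ → ℂ → Matrix (Fin 2 × Fin 2) (Fin 2 × Fin 2) ℂ)
    (T : ℂ → Matrix (Fin 2) (Fin 2) (EndH H)) : Prop :=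
  ∀ lam mu : ℂ, lam ∈ Λ → mu ∈ Λ → adm lam mu →
    embedR (R lam mu) * aux1 (T lam) * aux2 (T mu)
      = aux2 (T mu) * aux1 (T lam) * embedR (R lam mu)

/-- Ordered product `∏_{k ∈ s} B k` of endomorphisms indexed by a finset of a linearly
ordered type, taken in increasing order of the index. -/
def finsetOpProd {ι : Type} [LinearOrder ι] (s : Finset ι) (B : ι → EndH H) : EndH H :=
  ((s.sort (· ≤ ·)).map B).prod


/-- Sum of `F y r` over all ways of extracting one element `y` from a list, `r` being the list
of the remaining elements in their original order. -/
def pickSum {X V : Type*} [AddCommMonoid V] : (X → List X → V) → List X → V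
  | _, [] => 0
  | F, a :: l => F a l + pickSum (fun y r => F y (a :: r)) l

theorem pickSum_congr {X V : Type*} [AddCommMonoid V] {l : List X} :
    ∀ {F G : X → List X → V}, (∀ y r, (y :: r).Perm l → F y r = G y r) →
      pickSum F l = pickSum G l := by
  induction l with
  | nil => intros; rfl
  | cons a l ih =>
    intro F G h
    rw [pickSum, pickSum, h a l (List.Perm.refl _)]
    congr 1
    refine ih fun y r hr => h _ _ ?_
    exact (List.Perm.swap a y r).trans (hr.cons a)

theorem pickSum_add {X V : Type*} [AddCommMonoid V] (l : List X) :
    ∀ F G : X → List X → V,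
      pickSum (fun y r => F y r + G y r) l = pickSum F l + pickSum G l := by
  induction l with
  | nil => intros; simp [pickSum]
  | cons a l ih =>
    intro F G
    simp only [pickSum, ih]
    abel

theorem map_pickSum {X V W : Type*} [AddCommMonoid V] [AddCommMonoid W] {E : Type*}
    [FunLike E V W] [AddMonoidHomClass E V W] (φ : E) (l : List X) :
    ∀ F : X → List X → V, φ (pickSum F l) = pickSum (fun y r => φ (F y r)) l := by
  induction l with
  | nil => intro F; simp only [pickSum, map_zero]
  | cons a l ih =>
    intro F
    rw [pickSum, map_add, ih, pickSum]

theorem smul_pickSum {X V : Type*} [AddCommGroup V] [Module ℂ V] (c : ℂ) (l : List X)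
    (F : X → List X → V) : c • pickSum F l = pickSum (fun y r => c • F y r) l :=
  map_pickSum (DistribSMul.toAddMonoidHom V c) l F

theorem pickSum_ofFn {X V : Type*} [AddCommMonoid V] (m : ℕ) :
    ∀ (F : X → List X → V) (u : Fin (m + 1) → X),
      pickSum F (List.ofFn u) =
        ∑ k : Fin (m + 1), F (u k) (List.ofFn fun i => u (k.succAbove i)) := by
  induction m with
  | zero => intro F u; simp [pickSum]
  | succ m ih =>
    intro F u
    rw [List.ofFn_succ, pickSum, ih, Fin.sum_univ_succ (n := m + 1)]
    simp only [Fin.zero_succAbove]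
    congr 1
    refine Finset.sum_congr rfl fun k _ => ?_
    rw [List.ofFn_succ (f := fun i => u (k.succ.succAbove i))]
    simp

theorem gXXZ_swap (eta x y : ℂ) : gXXZ eta y x = -gXXZ eta x y := by
  unfold gXXZ
  rw [← neg_sub x y, Complex.sinh_neg, div_neg]

theorem fXXZ_mul_gXXZ (eta x y z : ℂ) (hxy : Complex.sinh (x - y) ≠ 0)
    (hxz : Complex.sinh (x - z) ≠ 0) (hyz : Complex.sinh (y - z) ≠ 0) :
    fXXZ eta x y * gXXZ eta x z = gXXZ eta x y * gXXZ eta y z + gXXZ eta x z * fXXZ eta z y := by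
  unfold fXXZ gXXZ
  have hzy : Complex.sinh (z - y) = -Complex.sinh (y - z) := by
    rw [← Complex.sinh_neg, neg_sub]
  have e1 : z - y + eta = eta - (y - z) := by ring
  have e2 : x - z = (x - y) + (y - z) := by ring
  rw [hzy, e1]
  field_simp
  rw [e2]
  simp only [Complex.sinh_add, Complex.sinh_sub (eta)]
  ring



/-- The vector `B(l₁) ⋯ B(l_M) v`. -/
def betheVec (B : ℂ → EndH H) (l : List ℂ) (v : H) : H := ((l.map B).prod) v

@[simp] theorem betheVec_nil (B : ℂ → EndH H) (v : H) : betheVec B [] v = v := rfl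

@[simp] theorem betheVec_cons (B : ℂ → EndH H) (a : ℂ) (l : List ℂ) (v : H) :
    betheVec B (a :: l) v = B a (betheVec B l v) := by
  simp [betheVec]

theorem betheVec_smul (B : ℂ → EndH H) (l : List ℂ) (c : ℂ) (v : H) :
    betheVec B l (c • v) = c • betheVec B l v := by
  simp [betheVec]

theorem betheVec_comm {B : ℂ → EndH H} {X : EndH H} {l : List ℂ}
    (h : ∀ y ∈ l, Commute X (B y)) (v : H) :
    X (betheVec B l v) = betheVec B l (X v) := by
  induction l with
  | nil => rfl
  | cons a l ih =>
    have h1 := LinearMap.congr_fun (h a (by simp)).eq (betheVec B l v)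
    simp only [Module.End.mul_apply] at h1
    rw [betheVec_cons, betheVec_cons, h1, ih fun y hy => h y (by simp [hy])]

/-- Action of `D(x)` on a Bethe vector (wanted and unwanted terms). -/
theorem D_apply_betheVec (eta : ℂ) (Λ : Set ℂ) (B D : ℂ → EndH H) (v : H) (d : ℂ → ℂ)
    (hDB : ∀ x ∈ Λ, ∀ y ∈ Λ, Complex.sinh (x - y) ≠ 0 →
      D x * B y = fXXZ eta x y • (B y * D x) - gXXZ eta x y • (B x * D y))
    (hBB : ∀ x ∈ Λ, ∀ y ∈ Λ, Complex.sinh (x - y) ≠ 0 →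
      fXXZ eta x y • (B x * B y) = fXXZ eta x y • (B y * B x))
    (hD : ∀ x ∈ Λ, D x v = d x • v) (l : List ℂ) :
    ∀ x, (∀ y ∈ x :: l, y ∈ Λ) →
      (x :: l).Pairwise (fun y z => Complex.sinh (y - z) ≠ 0) →
      D x (betheVec B l v) = (d x * (l.map (fXXZ eta x)).prod) • betheVec B l v
        - pickSum (fun y r => (gXXZ eta x y * (d y * (r.map (fXXZ eta y)).prod)) •
            B x (betheVec B r v)) l := by
  induction l with
  | nil =>
    intro x hx _
    simp [pickSum, hD x (hx x (by simp))]
  | cons a l ih =>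
    intro x hx hp
    have hxΛ := hx x (by simp)
    have haΛ := hx a (by simp)
    rw [List.pairwise_cons] at hp
    obtain ⟨hp1, hp2⟩ := hp
    have hxa := hp1 a (by simp)
    have hp3 := List.pairwise_cons.1 hp2
    have h1 := LinearMap.congr_fun (hDB x hxΛ a haΛ hxa) (betheVec B l v)
    simp only [Module.End.mul_apply, LinearMap.sub_apply, LinearMap.smul_apply] at h1
    rw [betheVec_cons, h1,
      ih x (fun y hy => hx y (by simp only [List.mem_cons] at hy ⊢; tauto))
        (List.pairwise_cons.2 ⟨fun y hy => hp1 y (by simp [hy]), hp3.2⟩),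
      ih a (fun y hy => hx y (by simp only [List.mem_cons] at hy ⊢; tauto)) hp2]
    simp only [map_sub, map_smul, map_pickSum, smul_sub, smul_pickSum, pickSum,
      List.map_cons, List.prod_cons, betheVec_cons]
    have key : pickSum (fun y r => fXXZ eta x a •
          ((gXXZ eta x y * (d y * (r.map (fXXZ eta y)).prod)) • B a (B x (betheVec B r v)))) l
        = pickSum (fun y r => gXXZ eta x a •
          ((gXXZ eta a y * (d y * (r.map (fXXZ eta y)).prod)) • B x (B a (betheVec B r v)))) l
        + pickSum (fun y r => (gXXZ eta x y * (d y * (fXXZ eta y a *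
            (r.map (fXXZ eta y)).prod))) • B x (B a (betheVec B r v))) l := by
      rw [← pickSum_add]
      refine pickSum_congr fun y r hyr => ?_
      have hy : y ∈ l := hyr.subset (by simp)
      have hc := LinearMap.congr_fun (hBB x hxΛ a haΛ hxa) (betheVec B r v)
      simp only [Module.End.mul_apply, LinearMap.smul_apply] at hc
      rw [smul_comm, ← hc, smul_smul, smul_smul, ← add_smul]
      congr 1
      linear_combination (d y * (r.map (fXXZ eta y)).prod) *
        fXXZ_mul_gXXZ eta x a y hxa (hp1 y (by simp [hy])) (hp3.1 y hy)
    rw [key]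
    module

/-- Splitting off one site from a Bethe vector, when the `B`-operators of this site annihilate
the vacuum in pairs. -/
theorem betheVec_split (eta : ℂ) (Λ : Set ℂ) (A₁ B₁ B D : ℂ → EndH H) (v : H) (α d : ℂ → ℂ)
    (hDB : ∀ x ∈ Λ, ∀ y ∈ Λ, Complex.sinh (x - y) ≠ 0 →
      D x * B y = fXXZ eta x y • (B y * D x) - gXXZ eta x y • (B x * D y))
    (hBB : ∀ x ∈ Λ, ∀ y ∈ Λ, Complex.sinh (x - y) ≠ 0 →
      fXXZ eta x y • (B x * B y) = fXXZ eta x y • (B y * B x))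
    (hD : ∀ x ∈ Λ, D x v = d x • v)
    (hAB₁ : ∀ x ∈ Λ, ∀ y ∈ Λ, Complex.sinh (y - x) ≠ 0 →
      A₁ x * B₁ y = fXXZ eta y x • (B₁ y * A₁ x) - gXXZ eta y x • (B₁ x * A₁ y))
    (hBB₁ : ∀ x ∈ Λ, ∀ y ∈ Λ, B₁ x (B₁ y v) = 0)
    (hA₁ : ∀ x ∈ Λ, A₁ x v = α x • v)
    (cAB : ∀ x ∈ Λ, ∀ y ∈ Λ, Commute (A₁ x) (B y))
    (cBB : ∀ x ∈ Λ, ∀ y ∈ Λ, Commute (B₁ x) (B y))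
    (cBD : ∀ x ∈ Λ, ∀ y ∈ Λ, Commute (B₁ x) (D y))
    (l : List ℂ) (hl : ∀ y ∈ l, y ∈ Λ)
    (hp : l.Pairwise (fun y z => Complex.sinh (y - z) ≠ 0)) :
    betheVec (fun x => A₁ x * B x + B₁ x * D x) l v
      = (l.map α).prod • betheVec B l v
        + pickSum (fun y r => (d y * (r.map (fun z => α z * fXXZ eta y z)).prod) •
            B₁ y (betheVec B r v)) l := by
  induction l with
  | nil => simp [pickSum]
  | cons a l ih =>
    have haΛ := hl a (by simp)
    have hlΛ : ∀ y ∈ l, y ∈ Λ := fun y hy => hl y (by simp [hy])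
    have hp' := List.pairwise_cons.1 hp
    rw [betheVec_cons, ih hlΛ hp'.2]
    have hA : ∀ x ∈ Λ, ∀ r : List ℂ, (∀ y ∈ r, y ∈ Λ) →
        A₁ x (betheVec B r v) = α x • betheVec B r v := fun x hx r hr => by
      rw [betheVec_comm (fun y hy => cAB x hx y (hr y hy)), hA₁ x hx, betheVec_smul]
    have hB0 : ∀ x ∈ Λ, ∀ y ∈ Λ, ∀ r : List ℂ, (∀ y ∈ r, y ∈ Λ) →
        B₁ x (B₁ y (betheVec B r v)) = 0 := fun x hx y hy r hr => by
      rw [betheVec_comm (fun z hz => cBB y hy z (hr z hz)),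
        betheVec_comm (fun z hz => cBB x hx z (hr z hz)), hBB₁ x hx y hy]
      simp [betheVec]
    have cBB' : ∀ x ∈ Λ, ∀ y ∈ Λ, ∀ w, B x (B₁ y w) = B₁ y (B x w) := fun x hx y hy w =>
      (LinearMap.congr_fun (cBB y hy x hx).eq w).symm
    have cBD' : ∀ x ∈ Λ, ∀ y ∈ Λ, ∀ w, D x (B₁ y w) = B₁ y (D x w) := fun x hx y hy w =>
      (LinearMap.congr_fun (cBD y hy x hx).eq w).symm
    have hDa := D_apply_betheVec eta Λ B D v d hDB hBB hD l a hl hp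
    simp only [LinearMap.add_apply, Module.End.mul_apply, map_add, map_smul, map_pickSum,
      smul_add, pickSum_add]
    rw [hDa, ← betheVec_cons B a l, hA a haΛ (a :: l) hl]
    have h2 : pickSum (fun y r => (d y * (r.map (fun z => α z * fXXZ eta y z)).prod) •
          B₁ a (D a (B₁ y (betheVec B r v)))) l = pickSum (fun _ _ => (0 : ℂ) • v) l := by
      refine pickSum_congr fun y r hyr => ?_
      have hy : y ∈ Λ := hlΛ y (hyr.subset (by simp))
      have hr : ∀ z ∈ r, z ∈ Λ := fun z hz => hlΛ z (hyr.subset (by simp [hz]))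
      have := LinearMap.congr_fun (cBD a haΛ a haΛ).eq (B₁ y (betheVec B r v))
      simp only [Module.End.mul_apply] at this
      rw [this, hB0 a haΛ y hy r hr]
      simp
    have h1 : pickSum (fun y r => (d y * (r.map (fun z => α z * fXXZ eta y z)).prod) •
          A₁ a (B a (B₁ y (betheVec B r v)))) l
        = pickSum (fun y r => (d y * ((a :: r).map (fun z => α z * fXXZ eta y z)).prod) •
            B₁ y (betheVec B (a :: r) v)) l
          + (l.map α).prod • pickSum (fun y r => (gXXZ eta a y * (d y *
            (r.map (fXXZ eta y)).prod)) • B₁ a (B a (betheVec B r v))) l := by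
      rw [smul_pickSum, ← pickSum_add]
      refine pickSum_congr fun y r hyr => ?_
      have hyl : y ∈ l := hyr.subset (by simp)
      have hy : y ∈ Λ := hlΛ y hyl
      have hr : ∀ z ∈ a :: r, z ∈ Λ := fun z hz => by
        rcases List.mem_cons.1 hz with rfl | hz
        · exact haΛ
        · exact hlΛ z (hyr.subset (by simp [hz]))
      have hya : Complex.sinh (y - a) ≠ 0 := by
        rw [← neg_sub, Complex.sinh_neg]
        exact neg_ne_zero.2 (hp'.1 y hyl)
      have hx := LinearMap.congr_fun (hAB₁ a haΛ y hy hya) (betheVec B (a :: r) v)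
      simp only [Module.End.mul_apply, LinearMap.sub_apply, LinearMap.smul_apply] at hx
      rw [hA a haΛ _ hr, hA y hy _ hr, betheVec_cons, gXXZ_swap eta a y] at hx
      rw [cBB' a haΛ y hy, hx, ← (hyr.map α).prod_eq]
      simp only [List.map_cons, List.prod_cons, List.prod_map_mul, map_smul, betheVec_cons]
      module
    have h0 : pickSum (fun (_ : ℂ) (_ : List ℂ) => (0 : ℂ) • v) l = 0 := by
      rw [← smul_pickSum (0 : ℂ) l (fun _ _ => v), zero_smul]
    rw [h1, h2, h0]
    simp only [pickSum, List.map_cons, List.prod_cons, List.prod_map_mul, map_sub, map_smul,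
      map_pickSum, smul_pickSum, smul_sub, betheVec_cons]
    module

section RTT

theorem aux1_mul (S T : Matrix (Fin 2) (Fin 2) (EndH H)) : aux1 (S * T) = aux1 S * aux1 T := by
  ext1 ⟨a, b⟩ ⟨c, d⟩
  simp only [aux1, Matrix.mul_apply, Fintype.sum_prod_type]
  fin_cases b <;> fin_cases d <;> simp

theorem aux2_mul (S T : Matrix (Fin 2) (Fin 2) (EndH H)) : aux2 (S * T) = aux2 S * aux2 T := by
  ext1 ⟨a, b⟩ ⟨c, d⟩
  simp only [aux2, Matrix.mul_apply, Fintype.sum_prod_type]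
  fin_cases a <;> fin_cases c <;> simp

theorem aux1_mul_aux2_comm {S T : Matrix (Fin 2) (Fin 2) (EndH H)}
    (h : ∀ a b c d, Commute (S a b) (T c d)) : aux1 S * aux2 T = aux2 T * aux1 S := by
  ext1 ⟨a, b⟩ ⟨c, d⟩
  simp only [aux1, aux2, Matrix.mul_apply, Fintype.sum_prod_type]
  simp [(h a c b d).eq]

theorem aux1_one : aux1 (1 : Matrix (Fin 2) (Fin 2) (EndH H)) = 1 := by
  ext1 ⟨a, b⟩ ⟨c, d⟩
  fin_cases a <;> fin_cases b <;> fin_cases c <;> fin_cases d <;> simp [aux1]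

theorem aux2_one : aux2 (1 : Matrix (Fin 2) (Fin 2) (EndH H)) = 1 := by
  ext1 ⟨a, b⟩ ⟨c, d⟩
  fin_cases a <;> fin_cases b <;> fin_cases c <;> fin_cases d <;> simp [aux2]

theorem SatisfiesRTT.one (Λ : Set ℂ) (adm : ℂ → ℂ → Prop)
    (R : ℂ → ℂ → Matrix (Fin 2 × Fin 2) (Fin 2 × Fin 2) ℂ) :
    SatisfiesRTT Λ adm R (fun _ => (1 : Matrix (Fin 2) (Fin 2) (EndH H))) := by
  intro x y _ _ _
  simp [aux1_one, aux2_one]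

theorem SatisfiesRTT.mul {Λ : Set ℂ} {adm : ℂ → ℂ → Prop}
    {R : ℂ → ℂ → Matrix (Fin 2 × Fin 2) (Fin 2 × Fin 2) ℂ}
    {S T : ℂ → Matrix (Fin 2) (Fin 2) (EndH H)}
    (hS : SatisfiesRTT Λ adm R S) (hT : SatisfiesRTT Λ adm R T)
    (hc : ∀ x ∈ Λ, ∀ y ∈ Λ, ∀ a b c d, Commute (S x a b) (T y c d)) :
    SatisfiesRTT Λ adm R (fun x => S x * T x) := by
  intro x y hx hy hxy
  have h1 : aux1 (S x) * aux2 (T y) = aux2 (T y) * aux1 (S x) :=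
    aux1_mul_aux2_comm (hc x hx y hy)
  have h2 : aux1 (T x) * aux2 (S y) = aux2 (S y) * aux1 (T x) :=
    aux1_mul_aux2_comm fun a b c d => (hc y hy x hx c d a b).symm
  have h3 := hS x y hx hy hxy
  have h4 := hT x y hx hy hxy
  rw [aux1_mul, aux2_mul]
  calc embedR (R x y) * (aux1 (S x) * aux1 (T x)) * (aux2 (S y) * aux2 (T y))
      = embedR (R x y) * aux1 (S x) * (aux1 (T x) * aux2 (S y)) * aux2 (T y) := by
        simp only [mul_assoc]
    _ = (embedR (R x y) * aux1 (S x) * aux2 (S y)) * aux1 (T x) * aux2 (T y) := by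
        rw [h2]; simp only [mul_assoc]
    _ = aux2 (S y) * aux1 (S x) * (embedR (R x y) * aux1 (T x) * aux2 (T y)) := by
        rw [h3]; simp only [mul_assoc]
    _ = aux2 (S y) * (aux1 (S x) * aux2 (T y)) * aux1 (T x) * embedR (R x y) := by
        rw [h4]; simp only [mul_assoc]
    _ = _ := by rw [h1]; simp only [mul_assoc]

variable {Λ : Set ℂ} {eta : ℂ} {T : ℂ → Matrix (Fin 2) (Fin 2) (EndH H)}

theorem SatisfiesRTT.D_mul_B
    (h : SatisfiesRTT Λ (fun x y => Complex.sinh (x - y) ≠ 0) (RXXZ eta) T)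
    {x y : ℂ} (hx : x ∈ Λ) (hy : y ∈ Λ) (hxy : Complex.sinh (x - y) ≠ 0) :
    T x 1 1 * T y 0 1
      = fXXZ eta x y • (T y 0 1 * T x 1 1) - gXXZ eta x y • (T x 0 1 * T y 1 1) := by
  have := congrFun (congrFun (h x y hx hy hxy) (1, 0)) (1, 1)
  simp [Matrix.mul_apply, Fintype.sum_prod_type, aux1, aux2, embedR, RXXZ, Rfg] at this
  rw [← this]
  abel

theorem SatisfiesRTT.A_mul_B
    (h : SatisfiesRTT Λ (fun x y => Complex.sinh (x - y) ≠ 0) (RXXZ eta) T)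
    {x y : ℂ} (hx : x ∈ Λ) (hy : y ∈ Λ) (hyx : Complex.sinh (y - x) ≠ 0) :
    T x 0 0 * T y 0 1
      = fXXZ eta y x • (T y 0 1 * T x 0 0) - gXXZ eta y x • (T x 0 1 * T y 0 0) := by
  have := congrFun (congrFun (h y x hy hx hyx) (0, 0)) (1, 0)
  simp [Matrix.mul_apply, Fintype.sum_prod_type, aux1, aux2, embedR, RXXZ, Rfg] at this
  rw [this]
  abel

theorem SatisfiesRTT.B_mul_B
    (h : SatisfiesRTT Λ (fun x y => Complex.sinh (x - y) ≠ 0) (RXXZ eta) T)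
    {x y : ℂ} (hx : x ∈ Λ) (hy : y ∈ Λ) (hxy : Complex.sinh (x - y) ≠ 0) :
    fXXZ eta x y • (T x 0 1 * T y 0 1) = fXXZ eta x y • (T y 0 1 * T x 0 1) := by
  have := congrFun (congrFun (h x y hx hy hxy) (0, 0)) (1, 1)
  simpa [Matrix.mul_apply, Fintype.sum_prod_type, aux1, aux2, embedR, RXXZ, Rfg] using this

end RTT

section Monodromy

/-- The monodromy matrix `L₁(x) ⋯ L_N(x)`. -/
def monodromy {N : ℕ} (L : Fin N → ℂ → Matrix (Fin 2) (Fin 2) (EndH H)) (x : ℂ) :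
    Matrix (Fin 2) (Fin 2) (EndH H) :=
  (List.ofFn fun j => L j x).prod

theorem monodromy_zero (L : Fin 0 → ℂ → Matrix (Fin 2) (Fin 2) (EndH H)) (x : ℂ) :
    monodromy L x = 1 := by
  simp [monodromy]

theorem monodromy_succ {N : ℕ} (L : Fin (N + 1) → ℂ → Matrix (Fin 2) (Fin 2) (EndH H)) (x : ℂ) :
    monodromy L x = L 0 x * monodromy (fun j => L j.succ) x := by
  simp [monodromy, List.ofFn_succ]

theorem commute_monodromy {N : ℕ} (L : Fin N → ℂ → Matrix (Fin 2) (Fin 2) (EndH H)) (x : ℂ)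
    (X : EndH H) (h : ∀ j c d, Commute X (L j x c d)) (c d : Fin 2) :
    Commute X (monodromy L x c d) := by
  induction N generalizing c d with
  | zero =>
    rw [monodromy_zero, Matrix.one_apply]
    split_ifs
    · exact Commute.one_right X
    · exact Commute.zero_right X
  | succ N ih =>
    rw [monodromy_succ, Matrix.mul_apply]
    exact Commute.sum_right _ _ _ fun k _ =>
      (h 0 c k).mul_right (ih (fun j => L j.succ) (fun j => h j.succ) k d)

theorem satisfiesRTT_monodromy {N : ℕ} {Λ : Set ℂ} {adm : ℂ → ℂ → Prop}
    {R : ℂ → ℂ → Matrix (Fin 2 × Fin 2) (Fin 2 × Fin 2) ℂ}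
    (L : Fin N → ℂ → Matrix (Fin 2) (Fin 2) (EndH H))
    (hRTT : ∀ j, SatisfiesRTT Λ adm R (L j))
    (hcomm : ∀ i j : Fin N, i ≠ j → ∀ lam mu : ℂ, lam ∈ Λ → mu ∈ Λ →
      ∀ a b c d : Fin 2, Commute (L i lam a b) (L j mu c d)) :
    SatisfiesRTT Λ adm R (monodromy L) := by
  induction N with
  | zero =>
    rw [show monodromy L = fun _ => 1 from funext (monodromy_zero L)]
    exact SatisfiesRTT.one Λ adm R
  | succ N ih =>
    rw [show monodromy L = fun x => L 0 x * monodromy (fun j => L j.succ) x from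
      funext (monodromy_succ L)]
    refine (hRTT 0).mul (ih _ (fun j => hRTT j.succ) fun i j hij =>
      hcomm i.succ j.succ (by simpa using hij)) fun x hx y hy a b c d => ?_
    exact commute_monodromy _ _ _ (fun j c d => hcomm 0 j.succ (Fin.succ_ne_zero j).symm
      x y hx hy a b c d) c d

theorem monodromy_vacuum {N : ℕ} (L : Fin N → ℂ → Matrix (Fin 2) (Fin 2) (EndH H)) (x : ℂ)
    (hcomm : ∀ i j : Fin N, i ≠ j → ∀ a b c d : Fin 2, Commute (L i x a b) (L j x c d))
    (v : H) (d : Fin N → ℂ) (hD : ∀ j, L j x 1 1 v = d j • v) (hC : ∀ j, L j x 1 0 v = 0) :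
    monodromy L x 1 0 v = 0 ∧ monodromy L x 1 1 v = (∏ j, d j) • v := by
  induction N with
  | zero => simp [monodromy_zero]
  | succ N ih =>
    obtain ⟨h1, h2⟩ := ih (fun j => L j.succ)
      (fun i j hij => hcomm i.succ j.succ (by simpa using hij)) (fun j => d j.succ)
      (fun j => hD j.succ) (fun j => hC j.succ)
    have hX : ∀ a b, L 0 x 1 0 (monodromy (fun j => L j.succ) x a b v) = 0 := fun a b => by
      have hc := commute_monodromy (fun j => L j.succ) x (L 0 x 1 0)
        (fun j c d => hcomm 0 j.succ (Fin.succ_ne_zero j).symm 1 0 c d) a b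
      have := LinearMap.congr_fun hc.eq v
      simpa [hC 0] using this
    simp only [monodromy_succ, Matrix.mul_apply, Fin.sum_univ_two, LinearMap.add_apply,
      Module.End.mul_apply, hX, h1, h2, map_zero, map_smul, hD 0, Fin.prod_univ_succ]
    refine ⟨by simp, ?_⟩
    rw [zero_add, smul_smul, mul_comm]

end Monodromy

section LocalSum

/-- The permutation of `Fin (m + 1)` sending `0` to `k` and acting through `τ` between the
remaining elements. -/
def permCons {m : ℕ} (k : Fin (m + 1)) (τ : Equiv.Perm (Fin m)) : Equiv.Perm (Fin (m + 1)) :=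
  (finSuccEquiv' 0).trans ((Equiv.optionCongr τ).trans (finSuccEquiv' k).symm)

@[simp] theorem permCons_zero {m : ℕ} (k : Fin (m + 1)) (τ : Equiv.Perm (Fin m)) :
    permCons k τ 0 = k := by
  simp [permCons]

@[simp] theorem permCons_succ {m : ℕ} (k : Fin (m + 1)) (τ : Equiv.Perm (Fin m)) (i : Fin m) :
    permCons k τ i.succ = k.succAbove (τ i) := by
  have : finSuccEquiv' (0 : Fin (m + 1)) i.succ = some i := by
    rw [← Fin.succAbove_zero]; exact finSuccEquiv'_succAbove 0 i
  simp [permCons, this]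

theorem permCons_bijective (m : ℕ) :
    Function.Bijective fun p : Fin (m + 1) × Equiv.Perm (Fin m) => permCons p.1 p.2 := by
  rw [Fintype.bijective_iff_injective_and_card]
  constructor
  · rintro ⟨k, τ⟩ ⟨k', τ'⟩ h
    have h0 := DFunLike.congr_fun h 0
    simp only [permCons_zero] at h0
    subst h0
    refine Prod.ext rfl (Equiv.ext fun i => ?_)
    have hi := DFunLike.congr_fun h i.succ
    simpa using hi
  · simp [Fintype.card_perm, Nat.factorial_succ]

theorem sum_perm_succ {V : Type*} [AddCommMonoid V] (m : ℕ) (F : Equiv.Perm (Fin (m + 1)) → V) :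
    ∑ σ, F σ = ∑ k, ∑ τ, F (permCons k τ) := by
  rw [← Fintype.sum_prod_type', ← (permCons_bijective m).sum_comp]

/-- The strictly increasing maps `Fin M → Fin N`. -/
def incMaps (M N : ℕ) : Finset (Fin M → Fin N) :=
  Finset.univ.filter fun n => ∀ k l : Fin M, k < l → n k < n l

theorem incMaps_succ (M N : ℕ) :
    incMaps (M + 1) (N + 1) =
      (incMaps (M + 1) N).image (fun n => fun i => (n i).succ) ∪
      (incMaps M N).image (fun n => Fin.cons 0 fun i => (n i).succ) := by
  ext n
  simp only [incMaps, Finset.mem_filter, Finset.mem_univ, true_and, Finset.mem_union,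
    Finset.mem_image]
  constructor
  · intro h
    have hs : ∀ i : Fin M, n i.succ ≠ 0 := fun i =>
      Fin.ne_zero_of_lt (h 0 i.succ (Fin.succ_pos i))
    by_cases h0 : n 0 = 0
    · right
      refine ⟨fun i => (n i.succ).pred (hs i), fun k l hkl => ?_, ?_⟩
      · simpa using h k.succ l.succ (by simpa using hkl)
      · funext i
        refine Fin.cases ?_ (fun i => ?_) i <;> simp [h0]
    · left
      have hn : ∀ i, n i ≠ 0 := fun i => Fin.cases h0 hs i
      exact ⟨fun i => (n i).pred (hn i), fun k l hkl => by simpa using h k l hkl, by simp⟩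
  · rintro (⟨n', h, rfl⟩ | ⟨n', h, rfl⟩) k l hkl
    · simpa using h k l hkl
    · induction l using Fin.cases with
      | zero => simp at hkl
      | succ l =>
        induction k using Fin.cases with
        | zero => simp
        | succ k => simpa using h k l (by simpa using hkl)

theorem sum_incMaps_succ {V : Type*} [AddCommMonoid V] (M N : ℕ)
    (F : (Fin (M + 1) → Fin (N + 1)) → V) :
    ∑ n ∈ incMaps (M + 1) (N + 1), F n =
      ∑ n ∈ incMaps (M + 1) N, F (fun i => (n i).succ) +
      ∑ n ∈ incMaps M N, F (Fin.cons 0 fun i => (n i).succ) := by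
  rw [incMaps_succ, Finset.sum_union, Finset.sum_image, Finset.sum_image]
  · intro n _ n' _ h
    funext i
    have := congrFun h i.succ
    simpa using this
  · intro n _ n' _ h
    funext i
    have := congrFun h i
    simpa using this
  · rw [Finset.disjoint_left]
    simp only [Finset.mem_image, not_exists, not_and]
    rintro _ ⟨n, _, rfl⟩ n' _ h
    have := congrFun h 0
    simp only [Fin.cons_zero] at this
    exact Fin.succ_ne_zero _ this.symm

/-- The contribution of the sites `n` with spectral parameters `u` to the local expansion. -/
def localTerm (f : ℂ → ℂ → ℂ) {N M : ℕ} (B : Fin N → ℂ → EndH H) (α δ : Fin N → ℂ → ℂ) (v : H)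
    (n : Fin M → Fin N) (u : Fin M → ℂ) : H :=
  (∏ l : Fin M,
    ((∏ i ∈ Finset.univ.filter (fun i : Fin N => i < n l), α i (u l)) *
      (∏ j ∈ Finset.univ.filter (fun j : Fin N => n l < j), δ j (u l)) *
      (∏ r ∈ Finset.univ.filter (fun r : Fin M => l < r), f (u l) (u r)))) •
    ((List.ofFn fun k : Fin M => B (n k) (u k)).prod v)

theorem localTerm_succ (f : ℂ → ℂ → ℂ) {N M : ℕ} (B : Fin (N + 1) → ℂ → EndH H)
    (α δ : Fin (N + 1) → ℂ → ℂ) (v : H) (n : Fin M → Fin N) (u : Fin M → ℂ) :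
    localTerm f B α δ v (fun i => (n i).succ) u =
      (∏ l, α 0 (u l)) •
        localTerm f (fun j => B j.succ) (fun j => α j.succ) (fun j => δ j.succ) v n u := by
  simp only [localTerm, smul_smul]
  rw [← Finset.prod_mul_distrib]
  congr 1
  refine Finset.prod_congr rfl fun l _ => ?_
  simp only [Finset.prod_filter, Fin.prod_univ_succ, Fin.succ_lt_succ_iff, Fin.succ_pos,
    if_true, Fin.not_lt_zero, if_false, one_mul, mul_assoc]

theorem localTerm_cons (f : ℂ → ℂ → ℂ) {N M : ℕ} (B : Fin (N + 1) → ℂ → EndH H)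
    (α δ : Fin (N + 1) → ℂ → ℂ) (v : H) (n : Fin M → Fin N) (u : Fin (M + 1) → ℂ) :
    localTerm f B α δ v (Fin.cons 0 fun i => (n i).succ) u =
      ((∏ j : Fin N, δ j.succ (u 0)) * ∏ i : Fin M, (α 0 (u i.succ) * f (u 0) (u i.succ))) •
        B 0 (u 0) (localTerm f (fun j => B j.succ) (fun j => α j.succ) (fun j => δ j.succ) v n
          fun i => u i.succ) := by
  simp only [localTerm, map_smul, smul_smul, List.ofFn_succ, List.prod_cons, Fin.cons_zero,
    Fin.cons_succ, Module.End.mul_apply]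
  congr 1
  simp only [Finset.prod_filter, Fin.prod_univ_succ, Fin.succ_lt_succ_iff, Fin.succ_pos,
    if_true, Fin.not_lt_zero, if_false, one_mul, Finset.prod_mul_distrib, Finset.prod_const_one,
    Fin.cons_zero, Fin.cons_succ]
  ring

end LocalSum

theorem betheVec_monodromy (eta : ℂ) (N : ℕ) (Λ : Set ℂ)
    (L : Fin N → ℂ → Matrix (Fin 2) (Fin 2) (EndH H))
    (hRTT : ∀ j : Fin N,
      SatisfiesRTT Λ (fun lam mu => Complex.sinh (lam - mu) ≠ 0) (RXXZ eta) (L j))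
    (hcomm : ∀ i j : Fin N, i ≠ j → ∀ lam mu : ℂ, lam ∈ Λ → mu ∈ Λ →
      ∀ a b c d : Fin 2, Commute (L i lam a b) (L j mu c d))
    (v : H) (α δ : Fin N → ℂ → ℂ)
    (hA : ∀ j, ∀ x ∈ Λ, L j x 0 0 v = α j x • v)
    (hD : ∀ j, ∀ x ∈ Λ, L j x 1 1 v = δ j x • v)
    (hC : ∀ j, ∀ x ∈ Λ, L j x 1 0 v = 0)
    (hBB : ∀ j, ∀ x ∈ Λ, ∀ y ∈ Λ, L j x 0 1 (L j y 0 1 v) = 0)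
    (M : ℕ) (u : Fin M → ℂ) (hu : ∀ i, u i ∈ Λ)
    (hdist : ∀ j k : Fin M, j ≠ k → Complex.sinh (u j - u k) ≠ 0) :
    betheVec (fun x => monodromy L x 0 1) (List.ofFn u) v =
      ∑ n ∈ incMaps M N, ∑ σ : Equiv.Perm (Fin M),
        localTerm (fXXZ eta) (fun j x => L j x 0 1) α δ v n (fun i => u (σ i)) := by
  induction N generalizing M with
  | zero =>
    cases M with
    | zero => simp [incMaps, localTerm]
    | succ M =>
      rw [show incMaps (M + 1) 0 = ∅ from
        Finset.eq_empty_of_forall_notMem fun n => (n 0).elim0]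
      simp [List.ofFn_succ, monodromy_zero]
  | succ N ih =>
    cases M with
    | zero => simp [incMaps, localTerm]
    | succ M =>
      have hne : ∀ j : Fin N, (0 : Fin (N + 1)) ≠ j.succ := fun j => (Fin.succ_ne_zero j).symm
      have hcomm' : ∀ i j : Fin N, i ≠ j → ∀ lam mu : ℂ, lam ∈ Λ → mu ∈ Λ →
          ∀ a b c d : Fin 2, Commute (L i.succ lam a b) (L j.succ mu c d) :=
        fun i j hij => hcomm i.succ j.succ (by simpa using hij)
      have hT := satisfiesRTT_monodromy (fun j => L j.succ) (fun j => hRTT j.succ) hcomm'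
      have hc : ∀ x ∈ Λ, ∀ y ∈ Λ, ∀ a b c d,
          Commute (L 0 x a b) (monodromy (fun j => L j.succ) y c d) :=
        fun x hx y hy a b c d => commute_monodromy _ _ _
          (fun j c d => hcomm 0 j.succ (hne j) x y hx hy a b c d) c d
      have IH := ih (fun j => L j.succ) (fun j => hRTT j.succ) hcomm'
        (fun j => α j.succ) (fun j => δ j.succ) (fun j => hA j.succ) (fun j => hD j.succ)
        (fun j => hC j.succ) (fun j => hBB j.succ)
      have hsplit := betheVec_split eta Λ (fun x => L 0 x 0 0) (fun x => L 0 x 0 1)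
        (fun x => monodromy (fun j => L j.succ) x 0 1)
        (fun x => monodromy (fun j => L j.succ) x 1 1) v (α 0) (fun x => ∏ j : Fin N, δ j.succ x)
        (fun x hx y hy => hT.D_mul_B hx hy) (fun x hx y hy => hT.B_mul_B hx hy)
        (fun x hx => (monodromy_vacuum (fun j => L j.succ) x
          (fun i j hij => hcomm' i j hij x x hx hx) v (fun j => δ j.succ x)
          (fun j => hD j.succ x hx) (fun j => hC j.succ x hx)).2)
        (fun x hx y hy => (hRTT 0).A_mul_B hx hy) (hBB 0) (hA 0)
        (fun x hx y hy => hc x hx y hy 0 0 0 1) (fun x hx y hy => hc x hx y hy 0 1 0 1)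
        (fun x hx y hy => hc x hx y hy 0 1 1 1) (List.ofFn u)
        (List.forall_mem_ofFn_iff.2 hu)
        (List.pairwise_ofFn.2 fun i j hij => hdist i j hij.ne)
      have hB : (fun x => monodromy L x 0 1) = fun x =>
          L 0 x 0 0 * monodromy (fun j => L j.succ) x 0 1
            + L 0 x 0 1 * monodromy (fun j => L j.succ) x 1 1 := by
        funext x
        simp [monodromy_succ, Matrix.mul_apply]
      rw [hB, hsplit, IH (M + 1) u hu hdist, pickSum_ofFn, sum_incMaps_succ]
      congr 1
      · simp only [localTerm_succ, List.map_ofFn, List.prod_ofFn, Finset.smul_sum]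
        refine Finset.sum_congr rfl fun n _ => Finset.sum_congr rfl fun σ _ => ?_
        rw [Equiv.prod_comp σ fun l => α 0 (u l)]
        rfl
      · simp only [localTerm_cons, sum_perm_succ]
        rw [Finset.sum_comm]
        refine Finset.sum_congr rfl fun k _ => ?_
        rw [IH M (fun i => u (k.succAbove i)) (fun i => hu _)
          fun i j hij => hdist _ _ fun h => hij (Fin.succAbove_right_injective h)]
        simp only [map_sum, Finset.smul_sum]
        refine Finset.sum_congr rfl fun n _ => Finset.sum_congr rfl fun τ _ => ?_
        simp only [permCons_zero, permCons_succ, List.map_ofFn, List.prod_ofFn,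
          Function.comp_apply]
        rw [Equiv.prod_comp τ fun i =>
          α 0 (u (k.succAbove i)) * fXXZ eta (u k) (u (k.succAbove i))]

/-- local structure of formal Bethe vectors, XXZ case.  The sum over
`1 ≤ n₁ < ⋯ < n_M ≤ N` is encoded as a sum over strictly increasing maps
`n : Fin M → Fin N`. -/
theorem local_Bethe_vectors_XXZ {H : Type} [AddCommGroup H] [Module ℂ H]
    (eta : ℂ) (N : ℕ) (hN : 1 ≤ N) (xi : Fin N → ℂ) (Λ : Set ℂ)
    (L : Fin N → ℂ → Matrix (Fin 2) (Fin 2) (EndH H))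
    (hRTT : ∀ j : Fin N, SatisfiesRTT Λ (fun lam mu => Complex.sinh (lam - mu) ≠ 0) (RXXZ eta) (L j))
    (hcomm : ∀ i j : Fin N, i ≠ j → ∀ lam mu : ℂ, lam ∈ Λ → mu ∈ Λ →
      ∀ a b c d : Fin 2, Commute (L i lam a b) (L j mu c d))
    (v0 : H) (hv0 : v0 ≠ 0) (alpha delta : ℂ → ℂ → ℂ)
    (hA : ∀ (j : Fin N) (lam : ℂ), lam ∈ Λ → L j lam 0 0 v0 = alpha lam (xi j) • v0)
    (hD : ∀ (j : Fin N) (lam : ℂ), lam ∈ Λ → L j lam 1 1 v0 = delta lam (xi j) • v0)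
    (hC : ∀ (j : Fin N) (lam : ℂ), lam ∈ Λ → L j lam 1 0 v0 = 0)
    (hBB : ∀ (j : Fin N) (lam mu : ℂ), lam ∈ Λ → mu ∈ Λ →
      (L j lam 0 1) ((L j mu 0 1) v0) = 0)
    (M : ℕ) (lam : Fin M → ℂ) (hlam : ∀ i, lam i ∈ Λ)
    (hdist : ∀ j k : Fin M, j ≠ k → Complex.sinh (lam j - lam k) ≠ 0) :
    ((List.ofFn (fun i : Fin M =>
        (List.ofFn (fun j : Fin N => L j (lam i))).prod 0 1)).prod) v0
      = ∑ n ∈ Finset.univ.filter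
            (fun n : Fin M → Fin N => ∀ k l : Fin M, k < l → n k < n l),
          ∑ σ : Equiv.Perm (Fin M),
            ((∏ l : Fin M,
                ((∏ i ∈ Finset.univ.filter (fun i : Fin N => i < n l),
                    alpha (lam (σ l)) (xi i)) *
                  (∏ j ∈ Finset.univ.filter (fun j : Fin N => n l < j),
                    delta (lam (σ l)) (xi j)) *
                  (∏ r ∈ Finset.univ.filter (fun r : Fin M => l < r),
                    (fXXZ eta) (lam (σ l)) (lam (σ r))))) •
              (((List.ofFn (fun k : Fin M => L (n k) (lam (σ k)) 0 1)).prod) v0)) := by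
  have h := betheVec_monodromy eta N Λ L hRTT hcomm v0 (fun j x => alpha x (xi j))
    (fun j x => delta x (xi j)) hA hD hC (fun j x hx y hy => hBB j x y hx hy) M lam hlam hdist
  rw [betheVec, List.map_ofFn] at h
  exact h

end
end

section
/- (Algebraic Bethe ansatz eigenvalue theorem, XXX case.) Let T(λ) = [[A(λ),B(λ)],[C(λ),D(λ)]] be a monodromy matrix on a complex vector space H with domain Λ ⊆ ℂ satisfying the RTT relation with the rational (XXX-type) R-matrix, with a pseudovacuum |0⟩ and eigenvalue functions a, d. Let λ₁, …, λ_M ∈ Λ be pairwise distinct and satisfy the Bethe equations a(λ_k) ∏_{j≠k} f(λⱼ,λ_k) = d(λ_k) ∏_{j≠k} f(λ_k,λⱼ) for all k = 1, …, M, where f(λ,μ) = (λ−μ+1)/(λ−μ). Then for every μ ∈ Λ with μ ∉ {λ₁,…,λ_M}: (A(μ) + D(μ)) B(λ₁)⋯B(λ_M)|0⟩ = τ(μ) B(λ₁)⋯B(λ_M)|0⟩, where τ(μ) = a(μ) ∏_{a=1}^M f(λ_a,μ) + d(μ) ∏_{a=1}^M f(μ,λ_a). -/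
open scoped BigOperators

noncomputable section

variable {H : Type} [AddCommGroup H] [Module ℂ H]

/-- Repeated use of the exchange relation `X(w) B(p) = F(p,w) B(p) X(w) - G(p,w) B(w) X(p)`
moves `X` through products `Ψ s` of commuting operators `B (z i)`, `i ∈ s`, applied to a common
eigenvector `Ψ ∅` of all `X(w)`. -/
theorem exchange_apply {α ι V : Type*} [DecidableEq ι] [AddCommGroup V] [Module ℂ V]
    {X B : α → Module.End ℂ V} {F G : α → α → ℂ} {x : α → ℂ}
    (hB : ∀ p q, Commute (B p) (B q))
    (hXB : ∀ w p, p ≠ w → X w * B p = F p w • (B p * X w) - G p w • (B w * X p))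
    (hFG : ∀ k p w, k ≠ p → k ≠ w → p ≠ w →
      F p w * G k w - G p w * G k p = G k w * F p k)
    {z : ι → α} (hz : Function.Injective z) {Ψ : Finset ι → V}
    (hX : ∀ w, X w (Ψ ∅) = x w • Ψ ∅) (hΨ : ∀ s, ∀ p ∉ s, Ψ (insert p s) = B (z p) (Ψ s))
    (s : Finset ι) (w : α) (hw : ∀ i ∈ s, z i ≠ w) :
    X w (Ψ s) = (x w * ∏ i ∈ s, F (z i) w) • Ψ s -
      ∑ k ∈ s, (G (z k) w * x (z k) * ∏ j ∈ s.erase k, F (z j) (z k)) •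
        B w (Ψ (s.erase k)) := by
  induction s using Finset.induction_on generalizing w with
  | empty => simp [hX]
  | insert p s hp ih =>
    have hpw : z p ≠ w := hw p (Finset.mem_insert_self p s)
    have hsw : ∀ i ∈ s, z i ≠ w := fun i hi => hw i (Finset.mem_insert_of_mem hi)
    have hsp : ∀ i ∈ s, z i ≠ z p := fun i hi h => hp (hz h ▸ hi)
    have hexch := LinearMap.congr_fun (hXB w (z p) hpw) (Ψ s)
    simp only [Module.End.mul_apply, LinearMap.sub_apply, LinearMap.smul_apply] at hexch
    have hterm : ∀ k ∈ s,
        (G (z k) w * x (z k) * ∏ j ∈ (insert p s).erase k, F (z j) (z k)) •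
          B w (Ψ ((insert p s).erase k)) =
        F (z p) w • (G (z k) w * x (z k) * ∏ j ∈ s.erase k, F (z j) (z k)) •
          B (z p) (B w (Ψ (s.erase k))) -
        G (z p) w • (G (z k) (z p) * x (z k) * ∏ j ∈ s.erase k, F (z j) (z k)) •
          B w (B (z p) (Ψ (s.erase k))) := by
      intro k hk
      have hkp : p ≠ k := fun h => hp (h ▸ hk)
      have hpe : p ∉ s.erase k := fun h => hp (Finset.mem_of_mem_erase h)
      have hcomm := LinearMap.congr_fun (hB (z p) w).eq (Ψ (s.erase k))
      simp only [Module.End.mul_apply] at hcomm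
      rw [Finset.erase_insert_of_ne hkp, hΨ _ _ hpe, Finset.prod_insert hpe, hcomm,
        smul_smul, smul_smul, ← sub_smul]
      congr 1
      linear_combination
        -(x (z k) * ∏ j ∈ s.erase k, F (z j) (z k)) *
          hFG (z k) (z p) w (hsp k hk) (hsw k hk) hpw
    rw [Finset.sum_insert hp, Finset.sum_congr rfl hterm, Finset.sum_sub_distrib,
      ← Finset.smul_sum, ← Finset.smul_sum, Finset.erase_insert hp, hΨ _ _ hp, hexch, ih w hsw,
      ih (z p) hsp, Finset.prod_insert hp]
    simp only [map_sub, map_sum, map_smul]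
    module

theorem fXXX_eq_one_add {l m : ℂ} (h : l ≠ m) : fXXX l m = 1 + gXXX l m := by
  have := sub_ne_zero.mpr h
  unfold fXXX gXXX
  field_simp

theorem gXXX_swap (l m : ℂ) : gXXX m l = -gXXX l m := by
  unfold gXXX
  rw [← neg_sub l m, div_neg]

theorem fXXX_mul_gXXX_sub {k p w : ℂ} (hkp : k ≠ p) (hkw : k ≠ w) (hpw : p ≠ w) :
    fXXX p w * gXXX k w - gXXX p w * gXXX k p = gXXX k w * fXXX p k := by
  have h₁ := sub_ne_zero.mpr hkp
  have h₂ := sub_ne_zero.mpr hkw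
  have h₃ := sub_ne_zero.mpr hpw
  have h₄ := sub_ne_zero.mpr hkp.symm
  unfold fXXX gXXX
  field_simp
  ring

namespace SatisfiesRTT

variable {Λ : Set ℂ} {T : ℂ → Matrix (Fin 2) (Fin 2) (EndH H)}

/-- The components of the RTT relation for the rational R-matrix. -/
theorem commutator (hT : SatisfiesRTT Λ (fun l m => l ≠ m) RXXX T) {l m : ℂ}
    (hl : l ∈ Λ) (hm : m ∈ Λ) (h : l ≠ m) (i j k n : Fin 2) :
    T l i k * T m j n - T m j n * T l i k =
      gXXX l m • (T m j k * T l i n - T l j k * T m i n) := by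
  have key := congrFun (congrFun (hT l m hl hm h) (i, j)) (k, n)
  revert key
  fin_cases i <;> fin_cases j <;> fin_cases k <;> fin_cases n <;>
    simp [Matrix.mul_apply, Fintype.sum_prod_type, Fin.sum_univ_two, embedR, aux1, aux2, RXXX, Rfg,
      fXXX_eq_one_add h, add_smul, add_mul, mul_add] <;>
    intro key <;>
    linear_combination (norm := module) key

theorem commute_B (hT : SatisfiesRTT Λ (fun l m => l ≠ m) RXXX T) {l m : ℂ}
    (hl : l ∈ Λ) (hm : m ∈ Λ) : Commute (T l 0 1) (T m 0 1) := by
  rcases eq_or_ne l m with rfl | h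
  · exact Commute.refl _
  have h₁ := hT.commutator hl hm h 0 0 1 1
  have h₂ := hT.commutator hm hl h.symm 0 0 1 1
  rw [gXXX_swap] at h₂
  have h₃ : (2 : ℂ) • (T l 0 1 * T m 0 1 - T m 0 1 * T l 0 1) = 0 := by
    linear_combination (norm := module) h₁ - h₂
  exact sub_eq_zero.mp ((smul_eq_zero_iff_right two_ne_zero).mp h₃)

theorem A_mul_B_s15 (hT : SatisfiesRTT Λ (fun l m => l ≠ m) RXXX T) {l m : ℂ}
    (hl : l ∈ Λ) (hm : m ∈ Λ) (h : l ≠ m) :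
    T m 0 0 * T l 0 1 =
      fXXX l m • (T l 0 1 * T m 0 0) - gXXX l m • (T m 0 1 * T l 0 0) := by
  have h₁ := hT.commutator hl hm h 0 0 1 0
  rw [fXXX_eq_one_add h]
  linear_combination (norm := module) -h₁

theorem D_mul_B_s15 (hT : SatisfiesRTT Λ (fun l m => l ≠ m) RXXX T) {l m : ℂ}
    (hl : l ∈ Λ) (hm : m ∈ Λ) (h : l ≠ m) :
    T m 1 1 * T l 0 1 =
      fXXX m l • (T l 0 1 * T m 1 1) - gXXX m l • (T m 0 1 * T l 1 1) := by
  have h₁ := hT.commutator hm hl h.symm 1 0 1 1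
  rw [fXXX_eq_one_add h.symm]
  linear_combination (norm := module) h₁

end SatisfiesRTT

/-- algebraic Bethe ansatz eigenvalue theorem, XXX case: if the Bethe
equations hold then the formal Bethe vector is an eigenvector of the transfer matrix
`A(μ) + D(μ)` with eigenvalue `τ(μ)`. -/
theorem Bethe_eigenvalue_XXX {H : Type} [AddCommGroup H] [Module ℂ H]
    (Λ : Set ℂ) (T : ℂ → Matrix (Fin 2) (Fin 2) (EndH H))
    (hT : SatisfiesRTT Λ (fun lam mu => lam ≠ mu) RXXX T)
    (v0 : H) (hv0 : v0 ≠ 0) (a d : ℂ → ℂ)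
    (hA : ∀ lam : ℂ, lam ∈ Λ → T lam 0 0 v0 = a lam • v0)
    (hD : ∀ lam : ℂ, lam ∈ Λ → T lam 1 1 v0 = d lam • v0)
    (hC : ∀ lam : ℂ, lam ∈ Λ → T lam 1 0 v0 = 0)
    (M : ℕ) (lam : Fin M → ℂ) (hlam : ∀ i, lam i ∈ Λ)
    (hdist : Function.Injective lam)
    (hBethe : ∀ k : Fin M,
      a (lam k) * ∏ j ∈ Finset.univ.filter (fun j : Fin M => j ≠ k),
          fXXX (lam j) (lam k)
        = d (lam k) * ∏ j ∈ Finset.univ.filter (fun j : Fin M => j ≠ k),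
            fXXX (lam k) (lam j))
    (mu : ℂ) (hmu : mu ∈ Λ) (hmune : ∀ i : Fin M, mu ≠ lam i) :
    (T mu 0 0 + T mu 1 1) (((List.ofFn (fun i : Fin M => T (lam i) 0 1)).prod) v0)
      = (a mu * (∏ i : Fin M, fXXX (lam i) mu) + d mu * (∏ i : Fin M, fXXX mu (lam i))) •
          (((List.ofFn (fun i : Fin M => T (lam i) 0 1)).prod) v0) := by
  have hB : ∀ p q : Λ, Commute (T p 0 1) (T q 0 1) := fun p q => hT.commute_B p.2 q.2
  have hz : Function.Injective (fun i => (⟨lam i, hlam i⟩ : Λ)) :=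
    fun i j h => hdist (congrArg Subtype.val h)
  have hcomm : Pairwise (Function.onFun Commute fun i => T (lam i) 0 1) :=
    fun i j _ => hB ⟨lam i, hlam i⟩ ⟨lam j, hlam j⟩
  set Ψ : Finset (Fin M) → H := fun s =>
    s.noncommProd (fun i => T (lam i) 0 1) (hcomm.set_pairwise _) v0 with hΨ_def
  have hΨ_empty : Ψ ∅ = v0 := by simp [hΨ_def]
  have hΨ : ∀ s, ∀ p ∉ s, Ψ (insert p s) = T (lam p) 0 1 (Ψ s) := fun s p hp => by
    simp only [hΨ_def, Finset.noncommProd_insert_of_notMem _ _ _ _ hp, Module.End.mul_apply]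
  have hΨ_univ : (List.ofFn fun i => T (lam i) 0 1).prod v0 = Ψ Finset.univ := by
    have h := Finset.noncommProd_toFinset (List.finRange M) (fun i => T (lam i) 0 1)
      (hcomm.set_pairwise _) (List.nodup_finRange M)
    simp only [hΨ_def, List.ofFn_eq_map, ← h, List.toFinset_finRange]
  have hA' := exchange_apply (X := fun w : Λ => T w 0 0) (B := fun w : Λ => T w 0 1)
    (F := fun p q => fXXX p q) (G := fun p q => gXXX p q) (x := fun w => a w) hB
    (fun w p h => hT.A_mul_B_s15 p.2 w.2 (Subtype.coe_injective.ne h))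
    (fun k p w h₁ h₂ h₃ => fXXX_mul_gXXX_sub (Subtype.coe_injective.ne h₁)
      (Subtype.coe_injective.ne h₂) (Subtype.coe_injective.ne h₃))
    hz (fun w => by rw [hΨ_empty]; exact hA w w.2) hΨ Finset.univ ⟨mu, hmu⟩
    (fun i _ h => hmune i (congrArg Subtype.val h).symm)
  have hD' := exchange_apply (X := fun w : Λ => T w 1 1) (B := fun w : Λ => T w 0 1)
    (F := fun p q => fXXX q p) (G := fun p q => gXXX q p) (x := fun w => d w) hB
    (fun w p h => hT.D_mul_B_s15 p.2 w.2 (Subtype.coe_injective.ne h))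
    (fun k p w h₁ h₂ h₃ => by
      have h₁ := Subtype.coe_injective.ne h₁
      have h₂ := Subtype.coe_injective.ne h₂
      have h₃ := Subtype.coe_injective.ne h₃
      have h := fXXX_mul_gXXX_sub h₁ h₂ h₃
      rw [fXXX_eq_one_add h₃, fXXX_eq_one_add h₁.symm] at h
      rw [fXXX_eq_one_add h₃.symm, fXXX_eq_one_add h₁, gXXX_swap p w, gXXX_swap k w,
        gXXX_swap k p]
      rw [gXXX_swap k p] at h
      linear_combination h)
    hz (fun w => by rw [hΨ_empty]; exact hD w w.2) hΨ Finset.univ ⟨mu, hmu⟩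
    (fun i _ h => hmune i (congrArg Subtype.val h).symm)
  have hcancel : ∀ k ∈ Finset.univ,
      (gXXX mu (lam k) * d (lam k) * ∏ j ∈ Finset.univ.erase k, fXXX (lam k) (lam j)) •
        T mu 0 1 (Ψ (Finset.univ.erase k)) =
      -((gXXX (lam k) mu * a (lam k) * ∏ j ∈ Finset.univ.erase k, fXXX (lam j) (lam k)) •
        T mu 0 1 (Ψ (Finset.univ.erase k))) := by
    intro k _
    have h := hBethe k
    rw [Finset.filter_ne'] at h
    rw [← neg_smul, gXXX_swap (lam k) mu]
    congr 1
    linear_combination gXXX (lam k) mu * h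
  rw [Finset.sum_congr rfl hcancel, Finset.sum_neg_distrib] at hD'
  rw [hΨ_univ, LinearMap.add_apply, hA', hD']
  module

end
end

section
/- (Algebraic Bethe ansatz eigenvalue theorem, XXZ case.) Let T(λ) = [[A(λ),B(λ)],[C(λ),D(λ)]] be a monodromy matrix on a complex vector space H with domain Λ ⊆ ℂ satisfying the RTT relation with the trigonometric (XXZ-type) R-matrix with anisotropy η, with a pseudovacuum |0⟩ and eigenvalue functions a, d. Let λ₁, …, λ_M ∈ Λ satisfy sinh(λⱼ−λ_k) ≠ 0 for all j ≠ k and the Bethe equations a(λ_k) ∏_{j≠k} f(λⱼ,λ_k) = d(λ_k) ∏_{j≠k} f(λ_k,λⱼ) for all k = 1, …, M, where f(λ,μ) = sinh(λ−μ+η)/sinh(λ−μ). Then for every μ ∈ Λ with sinh(μ−λ_a) ≠ 0 for all a: (A(μ) + D(μ)) B(λ₁)⋯B(λ_M)|0⟩ = τ(μ) B(λ₁)⋯B(λ_M)|0⟩, where τ(μ) = a(μ) ∏_{a=1}^M f(λ_a,μ) + d(μ) ∏_{a=1}^M f(μ,λ_a). -/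
open scoped BigOperators

noncomputable section

variable {H : Type} [AddCommGroup H] [Module ℂ H]

/-- Moving `X μ` through an ordered product of operators `B`: if `X` and `B` satisfy quadratic exchange
relations with coefficients `p`, `q` (and `p` times the commutator of the `B` vanishes), then
`X μ` acts on the ordered product applied to an eigenvector of `X` by a wanted term and one
unwanted term for every factor. No commutativity of the `B` is needed. -/
theorem exchange_apply_prod {H : Type} [AddCommGroup H] [Module ℂ H]
    (X B : ℂ → EndH H) (p q : ℂ → ℂ → ℂ) (adm : ℂ → ℂ → Prop) (Λ : Set ℂ)
    (hsymm : ∀ l m, adm l m → adm m l)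
    (hXB : ∀ l ∈ Λ, ∀ m ∈ Λ, adm l m →
      X m * B l = p l m • (B l * X m) + q m l • (B m * X l))
    (hBB : ∀ l ∈ Λ, ∀ m ∈ Λ, adm l m → p l m • (B l * B m) = p l m • (B m * B l))
    (hpq : ∀ l m n, adm l m → adm m n → adm l n →
      p l m * q m n + q m l * q l n = q m n * p l n)
    (v : H) (x : ℂ → ℂ) (hX : ∀ l ∈ Λ, X l v = x l • v) (M : ℕ) :
    ∀ (lam : Fin M → ℂ), (∀ i, lam i ∈ Λ) → (∀ j k, j ≠ k → adm (lam j) (lam k)) →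
    ∀ m ∈ Λ, (∀ i, adm m (lam i)) →
      X m ((List.ofFn fun i => B (lam i)).prod v)
        = (x m * ∏ i, p (lam i) m) • (List.ofFn fun i => B (lam i)).prod v
          + ∑ k, (q m (lam k) * (x (lam k) * ∏ j, if j ≠ k then p (lam j) (lam k) else 1)) •
              B m ((List.ofFn fun j => if j ≠ k then B (lam j) else 1).prod v) := by
  induction M with
  | zero => intro lam _ _ m hm _; simp [hX m hm]
  | succ M ih =>
    intro lam hlam hdist m hm hadm
    have h0m := hsymm _ _ (hadm 0)
    have hlam' : ∀ i : Fin M, lam i.succ ∈ Λ := fun i => hlam _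
    have hdist' : ∀ j k : Fin M, j ≠ k → adm (lam j.succ) (lam k.succ) := fun j k h =>
      hdist _ _ (fun e => h (Fin.succ_injective _ e))
    have ihm := ih (fun i => lam i.succ) hlam' hdist' m hm (fun i => hadm _)
    have ih0 := ih (fun i => lam i.succ) hlam' hdist' (lam 0) (hlam 0)
      (fun i => hdist _ _ (Fin.succ_ne_zero i).symm)
    have hex : ∀ w, X m (B (lam 0) w)
        = p (lam 0) m • B (lam 0) (X m w) + q m (lam 0) • B m (X (lam 0) w) := fun w => by
      simpa using LinearMap.congr_fun (hXB _ (hlam 0) m hm h0m) w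
    have hcomm : ∀ w, p (lam 0) m • B (lam 0) (B m w) = p (lam 0) m • B m (B (lam 0) w) :=
      fun w => by simpa using LinearMap.congr_fun (hBB _ (hlam 0) m hm h0m) w
    have hcoef : ∀ k : Fin M, p (lam 0) m * q m (lam k.succ) + q m (lam 0) * q (lam 0) (lam k.succ)
        = q m (lam k.succ) * p (lam 0) (lam k.succ) := fun k =>
      hpq _ _ _ h0m (hadm _) (hdist _ _ (Fin.succ_ne_zero k).symm)
    rw [List.ofFn_succ, List.prod_cons, Module.End.mul_apply, hex, ihm, ih0, Fin.sum_univ_succ]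
    simp only [List.ofFn_succ, List.prod_cons, Module.End.mul_apply, Fin.prod_univ_succ, map_add,
      map_smul, map_sum, smul_add, Finset.smul_sum, ne_eq, not_true_eq_false, if_false, if_true,
      Fin.succ_ne_zero, (Fin.succ_ne_zero _).symm, not_false_eq_true, Fin.succ_inj, one_mul]
    have hsum : ∀ k : Fin M, ∀ (c : ℂ) (w : H),
        p (lam 0) m • (q m (lam k.succ) * c) • B (lam 0) (B m w)
          + q m (lam 0) • (q (lam 0) (lam k.succ) * c) • B m (B (lam 0) w)
        = (q m (lam k.succ) * (p (lam 0) (lam k.succ) * c)) • B m (B (lam 0) w) := by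
      intro k c w
      rw [smul_comm (p (lam 0) m), hcomm, smul_smul, smul_smul, ← add_smul]
      congr 1
      linear_combination c * hcoef k
    have hrw : ∀ k : Fin M, ∀ c e P : ℂ, c * (e * (p (lam 0) (lam k.succ) * P))
        = c * (p (lam 0) (lam k.succ) * (e * P)) := fun k c e P => by ring
    simp only [hrw, ← hsum, Finset.sum_add_distrib, smul_smul]
    rw [show x m * (p (lam 0) m * ∏ i : Fin M, p (lam i.succ) m)
      = p (lam 0) m * (x m * ∏ i : Fin M, p (lam i.succ) m) by ring]
    abel

theorem gXXZ_swap_s16 (η l m : ℂ) : gXXZ η m l = -gXXZ η l m := by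
  rw [gXXZ, gXXZ, ← neg_sub l m, Complex.sinh_neg, div_neg]

theorem fXXZ_neg (η l m : ℂ) : fXXZ (-η) l m = fXXZ η m l := by
  rw [fXXZ, fXXZ, ← neg_sub m l, ← neg_add, Complex.sinh_neg, Complex.sinh_neg, neg_div_neg_eq]

theorem gXXZ_neg (η l m : ℂ) : gXXZ (-η) l m = gXXZ η m l := by
  rw [gXXZ, gXXZ, ← neg_sub m l, Complex.sinh_neg, Complex.sinh_neg, neg_div_neg_eq]

theorem sinh_sub_ne_zero_symm {l m : ℂ} (h : Complex.sinh (l - m) ≠ 0) :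
    Complex.sinh (m - l) ≠ 0 := by
  rwa [← neg_sub, Complex.sinh_neg, neg_ne_zero]

theorem fXXZ_mul_gXXZ_add (η l m n : ℂ) (hlm : Complex.sinh (l - m) ≠ 0)
    (hmn : Complex.sinh (m - n) ≠ 0) (hln : Complex.sinh (l - n) ≠ 0) :
    fXXZ η l m * gXXZ η m n + gXXZ η m l * gXXZ η l n = gXXZ η m n * fXXZ η l n := by
  rw [gXXZ_swap_s16 η l m]
  simp only [fXXZ, gXXZ]
  have e : l - n = (l - m) + (m - n) := by ring
  rw [e] at hln ⊢
  generalize l - m = x at *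
  generalize m - n = y at *
  have key : Complex.sinh (x + η) * Complex.sinh (x + y) - Complex.sinh η * Complex.sinh y
      = Complex.sinh x * Complex.sinh (x + y + η) := by
    simp only [Complex.sinh_add, Complex.cosh_add]
    linear_combination Complex.sinh η * Complex.sinh y * Complex.cosh_sq_sub_sinh_sq x
  field_simp
  linear_combination Complex.sinh η * key

section RTT

variable {H : Type} [AddCommGroup H] [Module ℂ H] {eta : ℂ} {Λ : Set ℂ}
  {T : ℂ → Matrix (Fin 2) (Fin 2) (EndH H)}

theorem SatisfiesRTT.B_mul_B_s16
    (hT : SatisfiesRTT Λ (fun lam mu => Complex.sinh (lam - mu) ≠ 0) (RXXZ eta) T)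
    {l m : ℂ} (hl : l ∈ Λ) (hm : m ∈ Λ) (h : Complex.sinh (l - m) ≠ 0) :
    fXXZ eta l m • (T l 0 1 * T m 0 1) = fXXZ eta l m • (T m 0 1 * T l 0 1) := by
  simpa [Matrix.mul_apply, Fintype.sum_prod_type, embedR, aux1, aux2, RXXZ, Rfg] using
    congr_fun₂ (hT l m hl hm h) (0, 0) (1, 1)

theorem SatisfiesRTT.A_mul_B_s16
    (hT : SatisfiesRTT Λ (fun lam mu => Complex.sinh (lam - mu) ≠ 0) (RXXZ eta) T)
    {l m : ℂ} (hl : l ∈ Λ) (hm : m ∈ Λ) (h : Complex.sinh (l - m) ≠ 0) :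
    T m 0 0 * T l 0 1
      = fXXZ eta l m • (T l 0 1 * T m 0 0) + gXXZ eta m l • (T m 0 1 * T l 0 0) := by
  have := congr_fun₂ (hT l m hl hm h) (0, 0) (1, 0)
  simp [Matrix.mul_apply, Fintype.sum_prod_type, embedR, aux1, aux2, RXXZ, Rfg] at this
  rw [this, gXXZ_swap_s16 eta l m]
  module

theorem SatisfiesRTT.D_mul_B_s16
    (hT : SatisfiesRTT Λ (fun lam mu => Complex.sinh (lam - mu) ≠ 0) (RXXZ eta) T)
    {l m : ℂ} (hl : l ∈ Λ) (hm : m ∈ Λ) (h : Complex.sinh (l - m) ≠ 0) :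
    T m 1 1 * T l 0 1
      = fXXZ eta m l • (T l 0 1 * T m 1 1) + gXXZ eta l m • (T m 0 1 * T l 1 1) := by
  have := congr_fun₂ (hT m l hm hl (sinh_sub_ne_zero_symm h)) (1, 0) (1, 1)
  simp [Matrix.mul_apply, Fintype.sum_prod_type, embedR, aux1, aux2, RXXZ, Rfg] at this
  rw [← this, gXXZ_swap_s16 eta l m]
  module

end RTT

/-- algebraic Bethe ansatz eigenvalue theorem, XXZ case: if the Bethe
equations hold then the formal Bethe vector is an eigenvector of the transfer matrix
`A(μ) + D(μ)` with eigenvalue `τ(μ)`. -/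
theorem Bethe_eigenvalue_XXZ {H : Type} [AddCommGroup H] [Module ℂ H]
    (eta : ℂ) (Λ : Set ℂ) (T : ℂ → Matrix (Fin 2) (Fin 2) (EndH H))
    (hT : SatisfiesRTT Λ (fun lam mu => Complex.sinh (lam - mu) ≠ 0) (RXXZ eta) T)
    (v0 : H) (hv0 : v0 ≠ 0) (a d : ℂ → ℂ)
    (hA : ∀ lam : ℂ, lam ∈ Λ → T lam 0 0 v0 = a lam • v0)
    (hD : ∀ lam : ℂ, lam ∈ Λ → T lam 1 1 v0 = d lam • v0)
    (hC : ∀ lam : ℂ, lam ∈ Λ → T lam 1 0 v0 = 0)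
    (M : ℕ) (lam : Fin M → ℂ) (hlam : ∀ i, lam i ∈ Λ)
    (hdist : ∀ j k : Fin M, j ≠ k → Complex.sinh (lam j - lam k) ≠ 0)
    (hBethe : ∀ k : Fin M,
      a (lam k) * ∏ j ∈ Finset.univ.filter (fun j : Fin M => j ≠ k),
          (fXXZ eta) (lam j) (lam k)
        = d (lam k) * ∏ j ∈ Finset.univ.filter (fun j : Fin M => j ≠ k),
            (fXXZ eta) (lam k) (lam j))
    (mu : ℂ) (hmu : mu ∈ Λ) (hmune : ∀ i : Fin M, Complex.sinh (mu - lam i) ≠ 0) :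
    (T mu 0 0 + T mu 1 1) (((List.ofFn (fun i : Fin M => T (lam i) 0 1)).prod) v0)
      = (a mu * (∏ i : Fin M, (fXXZ eta) (lam i) mu) + d mu * (∏ i : Fin M, (fXXZ eta) mu (lam i))) •
          (((List.ofFn (fun i : Fin M => T (lam i) 0 1)).prod) v0) := by
  have hAv := exchange_apply_prod (fun l => T l 0 0) (fun l => T l 0 1) (fXXZ eta) (gXXZ eta)
    (fun l m => Complex.sinh (l - m) ≠ 0) Λ (fun _ _ => sinh_sub_ne_zero_symm)
    (fun l hl m hm h => hT.A_mul_B_s16 hl hm h) (fun l hl m hm h => hT.B_mul_B_s16 hl hm h)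
    (fXXZ_mul_gXXZ_add eta) v0 a hA M lam hlam hdist mu hmu hmune
  have hDv := exchange_apply_prod (fun l => T l 1 1) (fun l => T l 0 1)
    (fun l m => fXXZ eta m l) (fun l m => gXXZ eta m l)
    (fun l m => Complex.sinh (l - m) ≠ 0) Λ (fun _ _ => sinh_sub_ne_zero_symm)
    (fun l hl m hm h => hT.D_mul_B_s16 hl hm h)
    (fun l hl m hm h => (hT.B_mul_B_s16 hm hl (sinh_sub_ne_zero_symm h)).symm)
    (fun l m n hlm hmn hln => by
      simpa only [fXXZ_neg, gXXZ_neg] using fXXZ_mul_gXXZ_add (-eta) l m n hlm hmn hln)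
    v0 d hD M lam hlam hdist mu hmu hmune
  simp only [Finset.prod_filter] at hBethe
  rw [LinearMap.add_apply, hAv, hDv, add_add_add_comm, ← add_smul, ← Finset.sum_add_distrib,
    Finset.sum_eq_zero, add_zero]
  intro k _
  rw [← add_smul, hBethe k, gXXZ_swap_s16 eta mu (lam k), neg_mul, add_neg_cancel, zero_smul]

end
end
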